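/- arXiv:2511.21278 — 2 statements merged into one kernel-verified Lean document; each statement's English description precedes it below -/
import Mathlib

section
/- For fixed σ² > 0, the Q-function Q(θ|θ̂) is maximized over β ∈ ℝ^p at β̂⁺ = (X̃ᵀX̃ + Σ_{i=1}^n Σ̃_{i,mis|obs})^{-1} X̃ᵀY, provided the p×p matrix X̃ᵀX̃ + Σ_{i=1}^n Σ̃_{i,mis|obs} is invertible, where X̃ = (x̃_1,…,x̃_n)ᵀ is the pseudo-complete design matrix (missing blocks imputed by their conditional means under θ̂), Y = (y_1,…,y_n)ᵀ, and Σ̃_{i,mis|obs} is the p×p matrix whose (j, j′) block equals the corresponding block of the conditional covariance Σ_{i,mis|obs} (under θ̂) when j, j′ ∈ Δ_{i,mis} and is zero otherwise. -/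
open Matrix

/-- For fixed `σ² > 0`, the Q-function (whose β-dependent part is
`−(1/(2nσ²)) Σ_i [(y_i − x̃_iᵀβ)² + βᵀ Σ̃_{i,mis|obs} β]`, the remaining terms being an
additive constant `C0` in `β`) is maximized over `β ∈ ℝ^p` at
`β̂⁺ = (X̃ᵀX̃ + Σ_i Σ̃_{i,mis|obs})⁻¹ X̃ᵀ Y`, provided that matrix is invertible. Here the
matrices `A i = Σ̃_{i,mis|obs}` (the conditional covariances padded by zeros outside the
missing blocks) are positive semidefinite. -/
theorem stmt4 (n p : ℕ) (hn : 0 < n) (σ2 : ℝ) (hσ : 0 < σ2)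
    (X : Matrix (Fin n) (Fin p) ℝ) (Y : Fin n → ℝ)
    (A : Fin n → Matrix (Fin p) (Fin p) ℝ) (hA : ∀ i, (A i).PosSemidef)
    (C0 : ℝ) (Q : (Fin p → ℝ) → ℝ)
    (hQ : Q = fun b =>
      C0 - (1 / (2 * n * σ2)) *
        ∑ i, ((Y i - ∑ j, X i j * b j) ^ 2 + b ⬝ᵥ (A i).mulVec b))
    (hinv : IsUnit (Xᵀ * X + ∑ i, A i).det) :
    ∀ b : Fin p → ℝ, Q b ≤ Q ((Xᵀ * X + ∑ i, A i)⁻¹.mulVec (Xᵀ.mulVec Y)) := by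
  set M := Xᵀ * X + ∑ i, A i with hM
  have hXX : (Xᵀ * X).PosSemidef := by
    simpa [Matrix.conjTranspose_eq_transpose_of_trivial] using
      Matrix.posSemidef_conjTranspose_mul_self X
  have hMp : M.PosSemidef := hXX.add (Matrix.posSemidef_sum _ fun i _ => hA i)
  have hMs : Mᵀ = M := by
    have h := hMp.1
    rwa [Matrix.IsHermitian, Matrix.conjTranspose_eq_transpose_of_trivial] at h
  set c := M⁻¹.mulVec (Xᵀ.mulVec Y) with hc
  have hMc : M.mulVec c = Xᵀ.mulVec Y := by
    rw [hc, Matrix.mulVec_mulVec, Matrix.mul_nonsing_inv _ hinv, Matrix.one_mulVec]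
  have hF : ∀ b : Fin p → ℝ,
      ∑ i, ((Y i - ∑ j, X i j * b j) ^ 2 + b ⬝ᵥ (A i).mulVec b)
        = Y ⬝ᵥ Y - 2 * (b ⬝ᵥ M.mulVec c) + b ⬝ᵥ M.mulVec b := by
    intro b
    have h1 : b ⬝ᵥ M.mulVec c = X.mulVec b ⬝ᵥ Y := by
      rw [hMc, Matrix.dotProduct_mulVec, Matrix.vecMul_transpose]
    have h2 : b ⬝ᵥ M.mulVec b
        = X.mulVec b ⬝ᵥ X.mulVec b + ∑ i, b ⬝ᵥ (A i).mulVec b := by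
      rw [hM, Matrix.add_mulVec, dotProduct_add, ← Matrix.mulVec_mulVec,
        Matrix.dotProduct_mulVec, Matrix.vecMul_transpose, Matrix.sum_mulVec,
        dotProduct_sum]
    rw [h1, h2, Finset.sum_add_distrib, ← add_assoc]
    congr 1
    have h3 : ∀ i, ∑ j, X i j * b j = X.mulVec b i := fun i => rfl
    simp only [h3, dotProduct, Finset.mul_sum, ← Finset.sum_sub_distrib,
      ← Finset.sum_add_distrib]
    exact Finset.sum_congr rfl fun i _ => by ring
  intro b
  have hsym : c ⬝ᵥ M.mulVec b = b ⬝ᵥ M.mulVec c := by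
    rw [Matrix.dotProduct_mulVec, dotProduct_comm, ← Matrix.mulVec_transpose, hMs]
  have hpos : 0 ≤ (b - c) ⬝ᵥ M.mulVec (b - c) := by
    simpa using hMp.dotProduct_mulVec_nonneg (b - c)
  rw [Matrix.mulVec_sub, dotProduct_sub, sub_dotProduct, sub_dotProduct, hsym] at hpos
  rw [hQ]
  simp only [hF]
  have hk : (0 : ℝ) ≤ 1 / (2 * n * σ2) := by positivity
  have := mul_le_mul_of_nonneg_left (a := 1 / (2 * (n : ℝ) * σ2))
    (b := Y ⬝ᵥ Y - 2 * (c ⬝ᵥ M.mulVec c) + c ⬝ᵥ M.mulVec c)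
    (c := Y ⬝ᵥ Y - 2 * (b ⬝ᵥ M.mulVec c) + b ⬝ᵥ M.mulVec b) (by linarith) hk
  linarith
end

section
/- Let 0 < λ_min ≤ λ_max, C > 0, ξ₁ ≥ 0, ξ₂ > 0, and set δ = (1 + [λ_max(ξ₁+ξ₂)²]^{-1})^{-1} and ξ = [(λ_max(2ξ₁+ξ₂) + λ_min ξ₂)δ + λ_max ξ₂](ξ₁+ξ₂). Suppose λ_min/(Cλ_max) > δ and 0 < ρ_min ≤ ρ_max < (λ_min/(Cλ_max) − δ)/ξ with ρ_min, ρ_max ≤ 1. Then γ := Cλ_max[ρ_max ξ + (1−ρ_min)δ] satisfies 0 < γ < λ_min, and consequently the contraction factor κ := 1 − 2(λ_min−γ)/(λ_max+λ_min) satisfies 0 < κ < 1. -/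
/-- The real-number inequality underlying Theorem 1: under the
assumptions of the paper, the quantity `γ = C λmax (ρmax ξ + (1 − ρmin) δ)` satisfies
`0 < γ < λmin`, and consequently the contraction factor
`κ = 1 − 2(λmin − γ)/(λmax + λmin)` lies strictly between 0 and 1. -/
theorem stmt9 (lmin lmax C ξ1 ξ2 ρmin ρmax δ ξ γ κ : ℝ)
    (hlmin_pos : 0 < lmin) (hle : lmin ≤ lmax) (hC : 0 < C)
    (hξ1 : 0 ≤ ξ1) (hξ2 : 0 < ξ2)
    (hδ : δ = (1 + (lmax * (ξ1 + ξ2) ^ 2)⁻¹)⁻¹)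
    (hξ : ξ = ((lmax * (2 * ξ1 + ξ2) + lmin * ξ2) * δ + lmax * ξ2) * (ξ1 + ξ2))
    (hcond : lmin / (C * lmax) > δ)
    (hρ1 : 0 < ρmin) (hρ2 : ρmin ≤ ρmax)
    (hρ3 : ρmax < (lmin / (C * lmax) - δ) / ξ)
    (hρ4 : ρmin ≤ 1) (hρ5 : ρmax ≤ 1)
    (hγ : γ = C * lmax * (ρmax * ξ + (1 - ρmin) * δ))
    (hκ : κ = 1 - 2 * (lmin - γ) / (lmax + lmin)) :
    (0 < γ ∧ γ < lmin) ∧ (0 < κ ∧ κ < 1) := by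
  have hl : 0 < lmax := by linarith
  have hs : 0 < ξ1 + ξ2 := by linarith
  have hδ0 : 0 < δ := by rw [hδ]; positivity
  have hξ0 : 0 < ξ := by rw [hξ]; positivity
  have hCl : 0 < C * lmax := by positivity
  have hρ0 : 0 < ρmax := by linarith
  have h1 : ρmax * ξ < lmin / (C * lmax) - δ := (lt_div_iff₀ hξ0).mp hρ3
  have h2 : 0 ≤ (1 - ρmin) * δ := mul_nonneg (by linarith) hδ0.le
  have h3 : 0 < ρmax * ξ := mul_pos hρ0 hξ0
  have h4 : 0 < ρmin * δ := mul_pos hρ1 hδ0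
  have hγ0 : 0 < γ := by rw [hγ]; exact mul_pos hCl (by linarith)
  have hγ1 : γ < lmin := by
    have h5 : ρmax * ξ + (1 - ρmin) * δ < lmin / (C * lmax) := by linarith
    rw [lt_div_iff₀ hCl] at h5
    rw [hγ]; linarith
  have hsum : 0 < lmax + lmin := by linarith
  refine ⟨⟨hγ0, hγ1⟩, ?_, ?_⟩
  · have h6 : 2 * (lmin - γ) / (lmax + lmin) < 1 := by
      rw [div_lt_one hsum]; linarith
    linarith
  · have h6 : 0 < 2 * (lmin - γ) / (lmax + lmin) := div_pos (by linarith) hsum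
    linarith
end
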